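/- arXiv:1412.3527 — 2 statements merged into one kernel-verified Lean document; each statement's English description precedes it below -/
import Mathlib

section
/- Let n, m, n', m' be positive integers with n + m = n' + m' and let μ, μ' > 0. If there exists a biholomorphism from the Fock–Bargmann–Hartogs domain D_{n,m}(μ) onto D_{n',m'}(μ'), then n = n' and m = m'. -/
/-- The Fock–Bargmann–Hartogs domain
`D_{n,m}(μ) = {(z,w) ∈ ℂ^n × ℂ^m : ‖w‖² < exp (−μ‖z‖²)}`. -/
def FBH (n m : ℕ) (μ : ℝ) :
    Set (EuclideanSpace ℂ (Fin n) × EuclideanSpace ℂ (Fin m)) :=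
  {p | ‖p.2‖ ^ 2 < Real.exp (-μ * ‖p.1‖ ^ 2)}

theorem FBH_isOpen (n m : ℕ) (μ : ℝ) : IsOpen (FBH n m μ) := by
  unfold FBH
  apply isOpen_lt <;> fun_prop

theorem FBH_zero_mem (n m : ℕ) (μ : ℝ) (z : EuclideanSpace ℂ (Fin n)) :
    (z, (0 : EuclideanSpace ℂ (Fin m))) ∈ FBH n m μ := by
  simp [FBH, Real.exp_pos]

theorem FBH_slice_differentiable {n m : ℕ} {μ : ℝ} {F : Type*} [NormedAddCommGroup F]
    [NormedSpace ℂ F] {f : EuclideanSpace ℂ (Fin n) × EuclideanSpace ℂ (Fin m) → F}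
    (hf : DifferentiableOn ℂ f (FBH n m μ)) :
    Differentiable ℂ (fun z : EuclideanSpace ℂ (Fin n) => f (z, 0)) := by
  intro z
  have h1 : DifferentiableAt ℂ f (z, 0) :=
    (hf _ (FBH_zero_mem n m μ z)).differentiableAt
      ((FBH_isOpen n m μ).mem_nhds (FBH_zero_mem n m μ z))
  exact DifferentiableAt.comp z (f := fun z : EuclideanSpace ℂ (Fin n) => (z, (0 : EuclideanSpace ℂ (Fin m)))) h1
    (by fun_prop)

theorem FBH_slice_zero {n m n' m' : ℕ} {μ μ' : ℝ} (hn : 0 < n) (hμ' : 0 < μ')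
    {f : EuclideanSpace ℂ (Fin n) × EuclideanSpace ℂ (Fin m) →
      EuclideanSpace ℂ (Fin n') × EuclideanSpace ℂ (Fin m')}
    (hf : DifferentiableOn ℂ f (FBH n m μ))
    (hmap : Set.MapsTo f (FBH n m μ) (FBH n' m' μ'))
    (hinj : Set.InjOn f (FBH n m μ)) (z : EuclideanSpace ℂ (Fin n)) :
    (f (z, 0)).2 = 0 := by
  have hd := FBH_slice_differentiable hf
  have hmem : ∀ z : EuclideanSpace ℂ (Fin n),
      ‖(f (z, 0)).2‖ ^ 2 < Real.exp (-μ' * ‖(f (z, 0)).1‖ ^ 2) :=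
    fun z => hmap (FBH_zero_mem n m μ z)
  have hb : ∀ z : EuclideanSpace ℂ (Fin n), ‖(f (z, 0)).2‖ ≤ 1 := by
    intro z
    have h1 : Real.exp (-μ' * ‖(f (z, 0)).1‖ ^ 2) ≤ 1 := by
      apply Real.exp_le_one_iff.2
      have : 0 ≤ μ' * ‖(f (z, 0)).1‖ ^ 2 := by positivity
      linarith
    have := hmem z
    nlinarith [norm_nonneg (f (z, 0)).2]
  have hc : ∀ x y : EuclideanSpace ℂ (Fin n), (f (x, 0)).2 = (f (y, 0)).2 := by
    intro x y
    refine Differentiable.apply_eq_apply_of_bounded (f := fun z => (f (z, 0)).2) hd.snd ?_ x y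
    refine isBounded_iff_forall_norm_le.2 ⟨1, ?_⟩
    rintro _ ⟨z, rfl⟩
    exact hb z
  by_contra hne
  have hpos : 0 < ‖(f (z, 0)).2‖ ^ 2 := by positivity
  have ha : ∀ x y : EuclideanSpace ℂ (Fin n), (f (x, 0)).1 = (f (y, 0)).1 := by
    intro x y
    refine Differentiable.apply_eq_apply_of_bounded (f := fun z => (f (z, 0)).1) hd.fst ?_ x y
    refine isBounded_iff_forall_norm_le.2
      ⟨1 + -Real.log (‖(f (z, 0)).2‖ ^ 2) / μ', ?_⟩
    rintro _ ⟨t, rfl⟩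
    have h1 := hmem t
    rw [hc t z, ← Real.log_lt_iff_lt_exp hpos] at h1
    have h2 : ‖(f (t, 0)).1‖ ^ 2 ≤ -Real.log (‖(f (z, 0)).2‖ ^ 2) / μ' := by
      rw [le_div_iff₀ hμ']
      linarith
    show ‖(f (t, 0)).1‖ ≤ _
    nlinarith [sq_nonneg (‖(f (t, 0)).1‖ - 1)]
  haveI : Nonempty (Fin n) := ⟨⟨0, hn⟩⟩
  obtain ⟨x, y, hxy⟩ := exists_pair_ne (EuclideanSpace ℂ (Fin n))
  exact hxy (congrArg Prod.fst (hinj (FBH_zero_mem n m μ x) (FBH_zero_mem n m μ y)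
    (Prod.ext (ha x y) (hc x y))))

/-- If there exists a biholomorphism between the equidimensional
Fock–Bargmann–Hartogs domains `D_{n,m}(μ)` and `D_{n',m'}(μ')`,
then `n = n'` and `m = m'`. -/
theorem biholomorphism_dimensions_eq
    (n m n' m' : ℕ) (hn : 0 < n) (hm : 0 < m) (hn' : 0 < n') (hm' : 0 < m')
    (hdim : n + m = n' + m') (μ μ' : ℝ) (hμ : 0 < μ) (hμ' : 0 < μ')
    (h : ∃ (f : EuclideanSpace ℂ (Fin n) × EuclideanSpace ℂ (Fin m) →
          EuclideanSpace ℂ (Fin n') × EuclideanSpace ℂ (Fin m'))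
        (g : EuclideanSpace ℂ (Fin n') × EuclideanSpace ℂ (Fin m') →
          EuclideanSpace ℂ (Fin n) × EuclideanSpace ℂ (Fin m)),
        DifferentiableOn ℂ f (FBH n m μ) ∧
        DifferentiableOn ℂ g (FBH n' m' μ') ∧
        Set.MapsTo f (FBH n m μ) (FBH n' m' μ') ∧
        Set.MapsTo g (FBH n' m' μ') (FBH n m μ) ∧
        (∀ x ∈ FBH n m μ, g (f x) = x) ∧
        (∀ y ∈ FBH n' m' μ', f (g y) = y)) :
    n = n' ∧ m = m' := by
  obtain ⟨f, g, hf, hg, mf, mg, gf, fg⟩ := h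
  have f0 := FBH_slice_zero hn hμ' hf mf (Set.LeftInvOn.injOn gf)
  have g0 := FBH_slice_zero hn' hμ hg mg (Set.LeftInvOn.injOn fg)
  let a : EuclideanSpace ℂ (Fin n) → EuclideanSpace ℂ (Fin n') := fun z => (f (z, 0)).1
  let b : EuclideanSpace ℂ (Fin n') → EuclideanSpace ℂ (Fin n) := fun z => (g (z, 0)).1
  have da : Differentiable ℂ a := (FBH_slice_differentiable hf).fst
  have db : Differentiable ℂ b := (FBH_slice_differentiable hg).fst
  have ba : b ∘ a = id := by
    funext z
    have h1 : ((f (z, 0)).1, (0 : EuclideanSpace ℂ (Fin m'))) = f (z, 0) :=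
      Prod.ext rfl (f0 z).symm
    show (g ((f (z, 0)).1, 0)).1 = z
    rw [h1, gf _ (FBH_zero_mem n m μ z)]
  have ab : a ∘ b = id := by
    funext z
    have h1 : ((g (z, 0)).1, (0 : EuclideanSpace ℂ (Fin m))) = g (z, 0) :=
      Prod.ext rfl (g0 z).symm
    show (f ((g (z, 0)).1, 0)).1 = z
    rw [h1, fg _ (FBH_zero_mem n' m' μ' z)]
  have hba : b (a 0) = 0 := congrFun ba 0
  have c1 : (fderiv ℂ b (a 0)).comp (fderiv ℂ a 0) = ContinuousLinearMap.id ℂ _ := by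
    rw [← fderiv_comp 0 (db _) (da _), ba, fderiv_id]
  have c2 : (fderiv ℂ a 0).comp (fderiv ℂ b (a 0)) = ContinuousLinearMap.id ℂ _ := by
    have := fderiv_comp (a 0) (da (b (a 0))) (db (a 0))
    rw [ab, fderiv_id, hba] at this
    exact this.symm
  have e := (ContinuousLinearEquiv.equivOfInverse' _ _ c2 c1).toLinearEquiv.finrank_eq
  simp only [finrank_euclideanSpace_fin] at e
  omega
end

section
/- Let n, n', m' be positive integers and μ' > 0. Suppose g : ℂ^n → ℂ^{n'} and h : ℂ^n → ℂ^{m'} are entire (everywhere holomorphic) maps satisfying ‖h(z)‖² < e^{−μ'‖g(z)‖²} for all z ∈ ℂ^n. If g is not constant, then h is identically zero. -/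
/-- If `g : ℂ^n → ℂ^{n'}` and `h : ℂ^n → ℂ^{m'}` are entire maps with
`‖h(z)‖² < exp (−μ'‖g(z)‖²)` for all `z`, and `g` is not constant, then `h ≡ 0`. -/
theorem entire_dominated_by_nonconstant_is_zero
    (n n' m' : ℕ) (hn : 0 < n) (hn' : 0 < n') (hm' : 0 < m') (μ' : ℝ) (hμ' : 0 < μ')
    (g : EuclideanSpace ℂ (Fin n) → EuclideanSpace ℂ (Fin n'))
    (h : EuclideanSpace ℂ (Fin n) → EuclideanSpace ℂ (Fin m'))
    (hg : Differentiable ℂ g) (hh : Differentiable ℂ h)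
    (hlt : ∀ z, ‖h z‖ ^ 2 < Real.exp (-μ' * ‖g z‖ ^ 2))
    (hgnc : ¬ ∃ c, ∀ z, g z = c) :
    ∀ z, h z = 0 := by
  have hbh : Bornology.IsBounded (Set.range h) := by
    rw [isBounded_iff_forall_norm_le]
    refine ⟨1, ?_⟩
    rintro _ ⟨z, rfl⟩
    have h1 : Real.exp (-μ' * ‖g z‖ ^ 2) ≤ 1 := by
      rw [Real.exp_le_one_iff]
      nlinarith [mul_nonneg hμ'.le (sq_nonneg ‖g z‖)]
    nlinarith [hlt z, norm_nonneg (h z)]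
  intro z₀
  by_contra hz
  have hpos : 0 < ‖h z₀‖ ^ 2 := by
    have := norm_pos_iff.mpr hz
    positivity
  apply hgnc
  refine ⟨g z₀, fun z => ?_⟩
  refine hg.apply_eq_apply_of_bounded ?_ z z₀
  rw [isBounded_iff_forall_norm_le]
  refine ⟨-Real.log (‖h z₀‖ ^ 2) / μ' + 1, ?_⟩
  rintro _ ⟨w, rfl⟩
  have h2 := hlt w
  rw [hh.apply_eq_apply_of_bounded hbh w z₀, ← Real.log_lt_iff_lt_exp hpos] at h2
  have h3 : ‖g w‖ ^ 2 ≤ -Real.log (‖h z₀‖ ^ 2) / μ' := by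
    rw [le_div_iff₀ hμ']
    linarith
  nlinarith [sq_nonneg (‖g w‖ - 1), norm_nonneg (g w)]
end
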